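/- Let V be a finite dimensional representation of the additive group 𝔾_a over a field 𝕜 of characteristic zero, of dimension n, so that V ≅ V_{n_1} ⊕ … ⊕ V_{n_k} with n = Σ_{j=1}^k (n_j+1) and the ring of invariants 𝕜[V]^{𝔾_a} equals ker D for the Weitzenböck derivation D. Then there exists a finite separating set S ⊆ ker D such that: (1) every element of S has total degree at most 2n−1; (2) the cardinality of S is at most 3n²; (3) every element of S lies in the 𝕜-subalgebra of R generated by the variables x_{i,j} with j ranging over at most two indices j₁, j₂ ∈ {1,…,k} (i.e., each element of S involves variables coming from at most 2 indecomposable summands). -/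

import Mathlib

/- STATEMENT 0: a finite separating set for an arbitrary linear `𝔾ₐ`-action in
characteristic zero, of size quadratic in `n = dim V`, with degrees `≤ 2n - 1`,
each element involving variables from at most two indecomposable summands. -/

open MvPolynomial Finset

/-- The variable `x_{i,j}` (as `X ⟨j,i⟩`), or `0` if `i` is out of range. -/
noncomputable def Xv (𝕜 : Type) [Field 𝕜] (k : ℕ) (n : Fin k → ℕ) (j : Fin k) (i : ℕ) :
    MvPolynomial (Σ j : Fin k, Fin (n j + 1)) 𝕜 :=
  if h : i ≤ n j then MvPolynomial.X ⟨j, ⟨i, Nat.lt_succ_of_le h⟩⟩ else 0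

/-- The Weitzenböck derivation `D` with `D x_{0,j} = 0` and `D x_{i,j} = x_{i-1,j}`. -/
noncomputable def Dw (𝕜 : Type) [Field 𝕜] (k : ℕ) (n : Fin k → ℕ) :
    Derivation 𝕜 (MvPolynomial (Σ j : Fin k, Fin (n j + 1)) 𝕜)
      (MvPolynomial (Σ j : Fin k, Fin (n j + 1)) 𝕜) :=
  mkDerivation 𝕜 fun v => if (v.2 : ℕ) = 0 then 0 else Xv 𝕜 k n v.1 ((v.2 : ℕ) - 1)

section Derivation

variable {𝕜 A : Type*} [CommRing 𝕜] [CommRing A] [Algebra 𝕜 A] (D : Derivation 𝕜 A A)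

theorem Derivation.iterate_mul_eq_zero {m p q : ℕ} {a b : A} (ha : D^[p] a = 0)
    (hb : D^[q] b = 0) (h : p + q ≤ m + 1) : D^[m] (a * b) = 0 := by
  induction m generalizing p q a b with
  | zero =>
    obtain rfl | rfl : p = 0 ∨ q = 0 := by omega
    · simp_all
    · simp_all
  | succ m ih =>
    rcases p with _ | p
    · rw [show a = 0 from ha, zero_mul, iterate_map_zero]
    rcases q with _ | q
    · rw [show b = 0 from hb, mul_zero, iterate_map_zero]
    rw [Function.iterate_succ_apply, D.leibniz, iterate_map_add, smul_eq_mul, smul_eq_mul,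
      ih ha (q := q) (by rwa [← Function.iterate_succ_apply]) (by omega),
      ih hb (q := p) (by rwa [← Function.iterate_succ_apply]) (by omega), add_zero]

theorem Derivation.iterate_pow_eq_zero {N : ℕ} {a : A} (ha : D^[N + 1] a = 0) (e : ℕ) :
    D^[e * N + 1] (a ^ e) = 0 := by
  induction e with
  | zero => simp
  | succ e ih => rw [pow_succ]; exact D.iterate_mul_eq_zero ih ha (by ring_nf; omega)

/-- The full transvectant of `a` and `b`, regarded as leading coefficients of forms of degree
`N`. -/
def Derivation.transvectant (N : ℕ) (a b : A) : A :=
  ∑ r ∈ range (N + 1), (-1) ^ r * (D^[r] a * D^[N - r] b)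

theorem Derivation.map_neg_one_pow_mul (r : ℕ) (a : A) : D ((-1) ^ r * a) = (-1) ^ r * D a := by
  rcases neg_one_pow_eq_or A r with h | h <;> simp [h]

theorem Derivation.map_transvectant {N : ℕ} {a b : A} (ha : D^[N + 1] a = 0)
    (hb : D^[N + 1] b = 0) : D (D.transvectant N a b) = 0 := by
  have key : ∀ r ∈ range (N + 1), D ((-1) ^ r * (D^[r] a * D^[N - r] b)) =
      (-1) ^ r * (D^[r] a * D^[N + 1 - r] b) -
      (-1) ^ (r + 1) * (D^[r + 1] a * D^[N + 1 - (r + 1)] b) := by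
    intro r hr
    rw [D.map_neg_one_pow_mul, D.leibniz, smul_eq_mul, smul_eq_mul,
      show N + 1 - r = (N - r) + 1 by have := mem_range.1 hr; omega, Nat.add_sub_add_right,
      Function.iterate_succ_apply' D (N - r), Function.iterate_succ_apply' D r]
    ring
  rw [transvectant, map_sum, sum_congr rfl key, sum_range_sub', ha, Nat.sub_zero, hb]
  simp

/-- An element mapped by `D` to the transvectant of `D y` with itself. -/
def Derivation.transvectantSlice (N : ℕ) (y : A) : A :=
  -∑ r ∈ range (N + 2), (-1) ^ r * (r * (D^[r] y * D^[N + 1 - r] y))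

theorem Derivation.map_transvectantSlice {N : ℕ} {y : A} (hy : D^[N + 2] y = 0) :
    D (D.transvectantSlice N y) = D.transvectant N (D y) (D y) := by
  set u : ℕ → A := fun r => (-1) ^ r * (D^[r] y * D^[N + 2 - r] y) with hu
  have key : ∀ r ∈ range (N + 2), D ((-1) ^ r * (r * (D^[r] y * D^[N + 1 - r] y))) =
      (r * u r - (r + 1 : ℕ) * u (r + 1)) + u (r + 1) := by
    intro r hr
    rw [D.map_neg_one_pow_mul, D.leibniz, D.leibniz, D.map_natCast, hu]
    simp only [smul_eq_mul]
    rw [show N + 2 - r = (N + 1 - r) + 1 by have := mem_range.1 hr; omega,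
      show N + 2 - (r + 1) = N + 1 - r by omega,
      Function.iterate_succ_apply' D (N + 1 - r), Function.iterate_succ_apply' D r]
    push_cast
    ring
  have hlast : u (N + 2) = 0 := by simp only [hu, hy, zero_mul, mul_zero]
  rw [transvectantSlice, map_neg, map_sum, sum_congr rfl key, sum_add_distrib, sum_range_sub',
    sum_range_succ, hlast, transvectant]
  simp only [Nat.cast_zero, zero_mul, mul_zero, sub_zero, add_zero, zero_add]
  rw [← sum_neg_distrib]
  refine sum_congr rfl fun r hr => ?_
  rw [hu, ← Function.iterate_succ_apply, ← Function.iterate_succ_apply]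
  simp only
  rw [show N + 2 - (r + 1) = N - r + 1 by have := mem_range.1 hr; omega]
  ring

/-- The ring homomorphism `a ↦ a + ε D a` to the dual numbers. -/
def Derivation.toDualNumber : A →+* DualNumber A where
  toFun a := TrivSqZeroExt.inl a + TrivSqZeroExt.inr (D a)
  map_one' := by simp
  map_zero' := by simp
  map_mul' a b := by ext <;> simp [mul_comm]
  map_add' a b := by ext <;> simp

theorem Derivation.map_det_eq_zero {m : ℕ} (M L : Matrix (Fin m) (Fin m) A)
    (hL : ∀ i j, i ≤ j → L i j = 0)
    (hM : ∀ i j, D (M i j) = (L * M) i j + (M * L.transpose) i j) : D M.det = 0 := by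
  set N : Matrix (Fin m) (Fin m) (DualNumber A) := M.map TrivSqZeroExt.inl with hN
  set E : Matrix (Fin m) (Fin m) (DualNumber A) := 1 + L.map TrivSqZeroExt.inr with hE
  have hEdet : E.det = 1 := by
    rw [Matrix.det_of_isLowerTriangular]
    · exact prod_eq_one fun i _ => by simp [hE, hL i i le_rfl]
    · intro i j hij
      have hij' : i < j := hij
      simp [hE, hL i j hij'.le, hij'.ne]
  have hfac : D.toDualNumber.mapMatrix M = E * N * E.transpose := by
    have h1 : L.map TrivSqZeroExt.inr * N = (L * M).map (TrivSqZeroExt.inr (R := A)) := by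
      ext i j <;>
        simp [hN, Matrix.mul_apply, TrivSqZeroExt.fst_sum, TrivSqZeroExt.snd_sum, mul_comm]
    have h2 : N * (L.map TrivSqZeroExt.inr).transpose =
        (M * L.transpose).map (TrivSqZeroExt.inr (R := A)) := by
      ext i j <;>
        simp [hN, Matrix.mul_apply, TrivSqZeroExt.fst_sum, TrivSqZeroExt.snd_sum, mul_comm]
    have h3 : (L * M).map (TrivSqZeroExt.inr (R := A)) *
        (L.map (TrivSqZeroExt.inr (R := A))).transpose = 0 := by
      ext i j <;> simp [Matrix.mul_apply]
    rw [hE, Matrix.transpose_add, Matrix.transpose_one, add_mul, one_mul, h1, mul_add, mul_one,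
      add_mul, h2, h3, add_zero]
    ext i j <;> simp [hN, toDualNumber, hM]
  have hdet := congrArg Matrix.det hfac
  rw [← RingHom.map_det, Matrix.det_mul, Matrix.det_mul, Matrix.det_transpose, hEdet, one_mul,
    mul_one, hN, show M.map TrivSqZeroExt.inl = (TrivSqZeroExt.inlHom A A).mapMatrix M from rfl,
    ← RingHom.map_det] at hdet
  simpa [toDualNumber] using congrArg TrivSqZeroExt.snd hdet

/-- The numerator of the invariant obtained from `x` by means of the local slice `s`, where
`D s = F`. -/
def Derivation.sliceNumerator {K B : Type*} [Field K] [CommRing B] [Algebra K B]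
    (D : Derivation K B B) (s F x : B) (i : ℕ) : B :=
  ∑ r ∈ range (i + 1), ((-1) ^ r / (r.factorial : K)) • (s ^ r * F ^ (i - r) * D^[r] x)

theorem Derivation.map_sliceNumerator {K B : Type*} [Field K] [CharZero K] [CommRing B]
    [Algebra K B] (D : Derivation K B B) {s F x : B} {i : ℕ} (hs : D s = F) (hF : D F = 0)
    (hx : D^[i + 1] x = 0) : D (D.sliceNumerator s F x i) = 0 := by
  set u : ℕ → B := fun r => (((-1) ^ (r + 1) * r / (r.factorial : K))) •
    (s ^ (r - 1) * F ^ (i + 1 - r) * D^[r] x) with hu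
  have key : ∀ r ∈ range (i + 1),
      D (((-1) ^ r / (r.factorial : K)) • (s ^ r * F ^ (i - r) * D^[r] x)) = u (r + 1) - u r := by
    intro r hr
    have hr' := mem_range.1 hr
    have hc : ((-1) ^ (r + 1 + 1) * ((r + 1 : ℕ) : K) / ((r + 1).factorial : K)) =
        (-1) ^ r / (r.factorial : K) := by
      have h1 : (r.factorial : K) ≠ 0 := Nat.cast_ne_zero.2 r.factorial_ne_zero
      have h2 : ((r + 1 : ℕ) : K) ≠ 0 := Nat.cast_ne_zero.2 r.succ_ne_zero
      rw [Nat.factorial_succ, Nat.cast_mul]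
      field_simp
      ring
    simp only [hu]
    rw [hc, D.map_smul, D.leibniz, D.leibniz, D.leibniz_pow, D.leibniz_pow, hs, hF,
      show i + 1 - (r + 1) = i - r by omega, show i + 1 - r = i - r + 1 by omega,
      Nat.add_sub_cancel,
      Function.iterate_succ_apply']
    simp only [smul_eq_mul, mul_zero, nsmul_eq_mul, zero_add, smul_add]
    rw [sub_eq_add_neg, ← neg_smul,
      show -((-1) ^ (r + 1) * (r : K) / (r.factorial : K)) = ((-1) ^ r / (r.factorial : K)) * r by
        ring, mul_smul, Nat.cast_smul_eq_nsmul, nsmul_eq_mul]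
    congr 2
    ring
  rw [sliceNumerator, map_sum, sum_congr rfl key, sum_range_sub]
  simp [hu, hx]

end Derivation

section Weitzenboeck

variable {𝕜 : Type} [Field 𝕜] {k : ℕ} {n : Fin k → ℕ}

theorem Xv_of_le {j : Fin k} {i : ℕ} (h : i ≤ n j) :
    Xv 𝕜 k n j i = X ⟨j, ⟨i, Nat.lt_succ_of_le h⟩⟩ := dif_pos h

theorem X_eq_Xv (v : Σ j : Fin k, Fin (n j + 1)) :
    (X v : MvPolynomial (Σ j : Fin k, Fin (n j + 1)) 𝕜) = Xv 𝕜 k n v.1 v.2 := by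
  rw [Xv_of_le (Nat.le_of_lt_succ v.2.2)]

theorem Dw_X (v : Σ j : Fin k, Fin (n j + 1)) :
    Dw 𝕜 k n (X v) = if (v.2 : ℕ) = 0 then 0 else Xv 𝕜 k n v.1 ((v.2 : ℕ) - 1) :=
  mkDerivation_X _ _ _

theorem Dw_Xv_zero (j : Fin k) : Dw 𝕜 k n (Xv 𝕜 k n j 0) = 0 := by
  rw [Xv_of_le (Nat.zero_le _), Dw_X]
  simp

theorem Dw_Xv_succ {j : Fin k} {i : ℕ} (h : i + 1 ≤ n j) :
    Dw 𝕜 k n (Xv 𝕜 k n j (i + 1)) = Xv 𝕜 k n j i := by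
  rw [Xv_of_le h, Dw_X]
  simp

theorem Dw_iterate_Xv {j : Fin k} {i r : ℕ} (h : i ≤ n j) (hr : r ≤ i) :
    (Dw 𝕜 k n)^[r] (Xv 𝕜 k n j i) = Xv 𝕜 k n j (i - r) := by
  induction r with
  | zero => rfl
  | succ r ih =>
    rw [Function.iterate_succ_apply', ih (by omega), show i - r = i - (r + 1) + 1 by omega,
      Dw_Xv_succ (by omega)]

theorem Dw_iterate_Xv_eq_zero {j : Fin k} {i : ℕ} (h : i ≤ n j) :
    (Dw 𝕜 k n)^[i + 1] (Xv 𝕜 k n j i) = 0 := by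
  rw [Function.iterate_succ_apply', Dw_iterate_Xv h le_rfl, Nat.sub_self, Dw_Xv_zero]

theorem totalDegree_Xv_le (j : Fin k) (i : ℕ) : (Xv 𝕜 k n j i).totalDegree ≤ 1 := by
  unfold Xv
  split_ifs
  · exact (totalDegree_X _).le
  · simp

theorem totalDegree_Dw_le (f : MvPolynomial (Σ j : Fin k, Fin (n j + 1)) 𝕜) :
    (Dw 𝕜 k n f).totalDegree ≤ f.totalDegree := by
  conv_lhs => rw [f.as_sum, map_sum]
  refine totalDegree_finsetSum_le fun s hs => ?_
  refine le_trans ?_ (le_totalDegree hs)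
  rw [Dw, mkDerivation_monomial]
  refine (totalDegree_smul_le _ _).trans (totalDegree_finsetSum_le fun i hi => ?_)
  simp only [smul_eq_mul]
  refine (totalDegree_mul _ _).trans ?_
  have hsub : s - Finsupp.single i 1 + Finsupp.single i 1 = s := by
    refine tsub_add_cancel_of_le ?_
    rw [Finsupp.single_le_iff]
    exact Nat.one_le_iff_ne_zero.2 (Finsupp.mem_support_iff.1 hi)
  have h1 := totalDegree_monomial_le (s - Finsupp.single i 1) ((s i : ℕ) : 𝕜)
  have h2 : (if (i.2 : ℕ) = 0 then 0 else Xv 𝕜 k n i.1 ((i.2 : ℕ) - 1)).totalDegree ≤ 1 := by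
    split_ifs
    · simp
    · exact totalDegree_Xv_le _ _
  conv_rhs => rw [← hsub, Finsupp.sum_add_index' (by simp) (by simp)]
  simp only [Finsupp.sum_single_index] at h1 ⊢
  exact add_le_add h1 h2

theorem totalDegree_Dw_iterate_le (f : MvPolynomial (Σ j : Fin k, Fin (n j + 1)) 𝕜) (r : ℕ) :
    ((Dw 𝕜 k n)^[r] f).totalDegree ≤ f.totalDegree := by
  induction r with
  | zero => rfl
  | succ r ih => rw [Function.iterate_succ_apply']; exact (totalDegree_Dw_le _).trans ih

theorem totalDegree_neg_one_pow_mul_le {σ : Type*} (r : ℕ) (f : MvPolynomial σ 𝕜) :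
    ((-1) ^ r * f).totalDegree ≤ f.totalDegree := by
  rcases neg_one_pow_eq_or (MvPolynomial σ 𝕜) r with h | h <;> simp [h]

theorem totalDegree_transvectant_le (N : ℕ)
    (a b : MvPolynomial (Σ j : Fin k, Fin (n j + 1)) 𝕜) :
    ((Dw 𝕜 k n).transvectant N a b).totalDegree ≤ a.totalDegree + b.totalDegree :=
  totalDegree_finsetSum_le fun _ _ => (totalDegree_neg_one_pow_mul_le _ _).trans <|
    (totalDegree_mul _ _).trans <|
      add_le_add (totalDegree_Dw_iterate_le _ _) (totalDegree_Dw_iterate_le _ _)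

theorem totalDegree_transvectantSlice_le (N : ℕ)
    (y : MvPolynomial (Σ j : Fin k, Fin (n j + 1)) 𝕜) :
    ((Dw 𝕜 k n).transvectantSlice N y).totalDegree ≤ y.totalDegree + y.totalDegree := by
  rw [Derivation.transvectantSlice, totalDegree_neg]
  refine totalDegree_finsetSum_le fun r _ => (totalDegree_neg_one_pow_mul_le _ _).trans ?_
  rw [← nsmul_eq_mul]
  exact (totalDegree_smul_le _ _).trans <| (totalDegree_mul _ _).trans <|
      add_le_add (totalDegree_Dw_iterate_le _ _) (totalDegree_Dw_iterate_le _ _)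

theorem totalDegree_sliceNumerator_le
    {s F x : MvPolynomial (Σ j : Fin k, Fin (n j + 1)) 𝕜} (hs : s.totalDegree ≤ 2)
    (hF : F.totalDegree ≤ 2) (hx : x.totalDegree ≤ 1) (i : ℕ) :
    ((Dw 𝕜 k n).sliceNumerator s F x i).totalDegree ≤ 2 * i + 1 := by
  refine totalDegree_finsetSum_le fun r hr => (totalDegree_smul_le _ _).trans ?_
  have h1 := totalDegree_mul (s ^ r * F ^ (i - r)) ((Dw 𝕜 k n)^[r] x)
  have h2 := totalDegree_mul (s ^ r) (F ^ (i - r))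
  have h3 := (totalDegree_pow s r).trans (Nat.mul_le_mul_left r hs)
  have h4 := (totalDegree_pow F (i - r)).trans (Nat.mul_le_mul_left (i - r) hF)
  have h5 := (totalDegree_Dw_iterate_le x r).trans hx
  have := mem_range.1 hr
  omega

/-- The subalgebra generated by the variables of two summands. -/
noncomputable abbrev twoSummands (𝕜 : Type) [Field 𝕜] {k : ℕ} (n : Fin k → ℕ) (j1 j2 : Fin k) :
    Subalgebra 𝕜 (MvPolynomial (Σ j : Fin k, Fin (n j + 1)) 𝕜) :=
  Algebra.adjoin 𝕜
    {p : MvPolynomial (Σ j : Fin k, Fin (n j + 1)) 𝕜 |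
      ∃ v : Σ j : Fin k, Fin (n j + 1), (v.1 = j1 ∨ v.1 = j2) ∧ p = MvPolynomial.X v}

theorem Xv_mem_twoSummands {j1 j2 j : Fin k} (hj : j = j1 ∨ j = j2) (i : ℕ) :
    Xv 𝕜 k n j i ∈ twoSummands 𝕜 n j1 j2 := by
  unfold Xv
  split_ifs
  · exact Algebra.subset_adjoin ⟨_, hj, rfl⟩
  · exact zero_mem _

theorem Dw_mem_twoSummands {j1 j2 : Fin k} {f : MvPolynomial (Σ j : Fin k, Fin (n j + 1)) 𝕜}
    (hf : f ∈ twoSummands 𝕜 n j1 j2) : Dw 𝕜 k n f ∈ twoSummands 𝕜 n j1 j2 := by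
  induction hf using Algebra.adjoin_induction with
  | mem x hx =>
    obtain ⟨v, hv, rfl⟩ := hx
    rw [Dw_X]
    split_ifs
    · exact zero_mem _
    · exact Xv_mem_twoSummands hv _
  | algebraMap r => rw [Derivation.map_algebraMap]; exact zero_mem _
  | add x y _ _ hx hy => rw [map_add]; exact add_mem hx hy
  | mul x y hx' hy' hx hy =>
    rw [Derivation.leibniz]
    exact add_mem (mul_mem hx' hy) (mul_mem hy' hx)

theorem Dw_iterate_mem_twoSummands {j1 j2 : Fin k}
    {f : MvPolynomial (Σ j : Fin k, Fin (n j + 1)) 𝕜}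
    (hf : f ∈ twoSummands 𝕜 n j1 j2) (r : ℕ) :
    (Dw 𝕜 k n)^[r] f ∈ twoSummands 𝕜 n j1 j2 := by
  induction r with
  | zero => exact hf
  | succ r ih => rw [Function.iterate_succ_apply']; exact Dw_mem_twoSummands ih

theorem neg_one_pow_mul_mem {B : Type*} [CommRing B] [Algebra 𝕜 B] (S : Subalgebra 𝕜 B) (r : ℕ)
    {f : B} (hf : f ∈ S) : (-1) ^ r * f ∈ S :=
  mul_mem (pow_mem (neg_mem (one_mem S)) r) hf

theorem transvectant_mem_twoSummands {j1 j2 : Fin k} (N : ℕ)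
    {a b : MvPolynomial (Σ j : Fin k, Fin (n j + 1)) 𝕜} (ha : a ∈ twoSummands 𝕜 n j1 j2)
    (hb : b ∈ twoSummands 𝕜 n j1 j2) :
    (Dw 𝕜 k n).transvectant N a b ∈ twoSummands 𝕜 n j1 j2 :=
  sum_mem fun _ _ => neg_one_pow_mul_mem _ _
    (mul_mem (Dw_iterate_mem_twoSummands ha _) (Dw_iterate_mem_twoSummands hb _))

theorem transvectantSlice_mem_twoSummands {j1 j2 : Fin k} (N : ℕ)
    {y : MvPolynomial (Σ j : Fin k, Fin (n j + 1)) 𝕜} (hy : y ∈ twoSummands 𝕜 n j1 j2) :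
    (Dw 𝕜 k n).transvectantSlice N y ∈ twoSummands 𝕜 n j1 j2 :=
  neg_mem <| sum_mem fun _ _ => neg_one_pow_mul_mem _ _ <| mul_mem (natCast_mem _ _)
    (mul_mem (Dw_iterate_mem_twoSummands hy _) (Dw_iterate_mem_twoSummands hy _))

theorem sliceNumerator_mem_twoSummands {j1 j2 : Fin k}
    {s F x : MvPolynomial (Σ j : Fin k, Fin (n j + 1)) 𝕜} (hs : s ∈ twoSummands 𝕜 n j1 j2)
    (hF : F ∈ twoSummands 𝕜 n j1 j2) (hx : x ∈ twoSummands 𝕜 n j1 j2) (i : ℕ) :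
    (Dw 𝕜 k n).sliceNumerator s F x i ∈ twoSummands 𝕜 n j1 j2 :=
  sum_mem fun _ _ => Subalgebra.smul_mem _
    (mul_mem (mul_mem (pow_mem hs _) (pow_mem hF _)) (Dw_iterate_mem_twoSummands hx _)) _

end Weitzenboeck

section Orbits

variable {𝕜 : Type} [Field 𝕜] {k : ℕ} {n : Fin k → ℕ}

/-- A tuple of polynomials `P j` of degree at most `n j` describes a point of the representation,
on which the additive group acts by translation of the argument; this is its translate by `s`. -/
noncomputable def orbitPoint (P : Fin k → Polynomial 𝕜) (s : 𝕜) :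
    (Σ j : Fin k, Fin (n j + 1)) → 𝕜 :=
  fun v => (Polynomial.derivative^[n v.1 - v.2] (P v.1)).eval s

/-- The pullback of functions along the orbit of the point described by `P`. -/
noncomputable def orbitMap (n : Fin k → ℕ) (P : Fin k → Polynomial 𝕜) :
    MvPolynomial (Σ j : Fin k, Fin (n j + 1)) 𝕜 →ₐ[𝕜] Polynomial 𝕜 :=
  aeval fun v => Polynomial.derivative^[n v.1 - v.2] (P v.1)

theorem eval_orbitMap (P : Fin k → Polynomial 𝕜) (s : 𝕜)
    (f : MvPolynomial (Σ j : Fin k, Fin (n j + 1)) 𝕜) :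
    (orbitMap n P f).eval s = eval (orbitPoint P s) f := by
  induction f using MvPolynomial.induction_on with
  | C a => simp [orbitMap]
  | add p q hp hq => simp [hp, hq]
  | mul_X p v hp => rw [map_mul, Polynomial.eval_mul, hp]; simp [orbitMap, orbitPoint]

theorem orbitMap_Xv (P : Fin k → Polynomial 𝕜) {j : Fin k} {i : ℕ} (h : i ≤ n j) :
    orbitMap n P (Xv 𝕜 k n j i) = Polynomial.derivative^[n j - i] (P j) := by
  rw [Xv_of_le h, orbitMap, aeval_X]

theorem derivative_orbitMap {P : Fin k → Polynomial 𝕜} (hP : ∀ j, (P j).natDegree ≤ n j)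
    (f : MvPolynomial (Σ j : Fin k, Fin (n j + 1)) 𝕜) :
    Polynomial.derivative (orbitMap n P f) = orbitMap n P (Dw 𝕜 k n f) := by
  induction f using MvPolynomial.induction_on with
  | C a => simp [orbitMap]
  | add p q hp hq => simp [hp, hq]
  | mul_X p v hp =>
    have hX : Polynomial.derivative (orbitMap n P (X v)) = orbitMap n P (Dw 𝕜 k n (X v)) := by
      obtain ⟨j, i, hi⟩ := v
      rw [X_eq_Xv, orbitMap_Xv _ (Nat.le_of_lt_succ hi), 
        ← Function.iterate_succ_apply' (⇑Polynomial.derivative)]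
      rcases i with _ | i
      · rw [Dw_Xv_zero, map_zero]
        exact Polynomial.iterate_derivative_eq_zero (Nat.lt_succ_of_le (hP j))
      · have hi' : i + 1 ≤ n j := Nat.le_of_lt_succ hi
        rw [Dw_Xv_succ hi', orbitMap_Xv _ (by omega)]
        congr 2
        omega
    rw [map_mul, Polynomial.derivative_mul, hp, hX, Derivation.leibniz, map_add, smul_eq_mul,
      smul_eq_mul, map_mul, map_mul]
    ring

theorem iterate_derivative_orbitMap {P : Fin k → Polynomial 𝕜} (hP : ∀ j, (P j).natDegree ≤ n j)
    (f : MvPolynomial (Σ j : Fin k, Fin (n j + 1)) 𝕜) (r : ℕ) :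
    Polynomial.derivative^[r] (orbitMap n P f) = orbitMap n P ((Dw 𝕜 k n)^[r] f) := by
  induction r with
  | zero => rfl
  | succ r ih =>
    rw [Function.iterate_succ_apply', ih, derivative_orbitMap hP, Function.iterate_succ_apply']

theorem eval_orbitPoint_eq [CharZero 𝕜] {P : Fin k → Polynomial 𝕜}
    (hP : ∀ j, (P j).natDegree ≤ n j) {f : MvPolynomial (Σ j : Fin k, Fin (n j + 1)) 𝕜}
    (hf : Dw 𝕜 k n f = 0) (s t : 𝕜) :
    eval (orbitPoint P s) f = eval (orbitPoint P t) f := by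
  have h := derivative_orbitMap hP f
  rw [hf, map_zero] at h
  rw [← eval_orbitMap, ← eval_orbitMap,
    Polynomial.eq_C_of_natDegree_eq_zero (Polynomial.derivative_eq_zero.1 h)]
  simp

theorem Polynomial.eval_zero_iterate_derivative {R : Type*} [CommSemiring R] (p : Polynomial R)
    (m : ℕ) : (Polynomial.derivative^[m] p).eval 0 = m.factorial * p.coeff m := by
  rw [← Polynomial.coeff_zero_eq_eval_zero, Polynomial.coeff_iterate_derivative, zero_add,
    Nat.descFactorial_self, nsmul_eq_mul]

/-- The tuple of polynomials describing the point `v`. -/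
noncomputable def pointForm (v : (Σ j : Fin k, Fin (n j + 1)) → 𝕜) (j : Fin k) : Polynomial 𝕜 :=
  ∑ i : Fin (n j + 1), Polynomial.C (v ⟨j, i⟩ / ((n j - i).factorial : 𝕜)) *
    Polynomial.X ^ (n j - i)

theorem natDegree_pointForm_le (v : (Σ j : Fin k, Fin (n j + 1)) → 𝕜) (j : Fin k) :
    (pointForm v j).natDegree ≤ n j :=
  Polynomial.natDegree_sum_le_of_forall_le _ _ fun _ _ =>
    (Polynomial.natDegree_C_mul_X_pow_le _ _).trans (Nat.sub_le _ _)

theorem coeff_pointForm (v : (Σ j : Fin k, Fin (n j + 1)) → 𝕜) (j : Fin k) (i : Fin (n j + 1)) :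
    (pointForm v j).coeff (n j - i) = v ⟨j, i⟩ / ((n j - i).factorial : 𝕜) := by
  rw [pointForm, Polynomial.finsetSum_coeff, Finset.sum_eq_single i]
  · simp
  · intro b _ hb
    rw [Polynomial.coeff_C_mul_X_pow, if_neg]
    intro h
    exact hb (Fin.ext (by omega))
  · simp

theorem orbitPoint_pointForm_zero [CharZero 𝕜] (v : (Σ j : Fin k, Fin (n j + 1)) → 𝕜) :
    orbitPoint (pointForm v) 0 = v := by
  funext ⟨j, i⟩
  rw [orbitPoint, Polynomial.eval_zero_iterate_derivative, coeff_pointForm]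
  field_simp [Nat.factorial_ne_zero]

theorem eval_sliceNumerator [CharZero 𝕜] (v : (Σ j : Fin k, Fin (n j + 1)) → 𝕜)
    {s F : MvPolynomial (Σ j : Fin k, Fin (n j + 1)) 𝕜} (hF : eval v F ≠ 0)
    (u : Σ j : Fin k, Fin (n j + 1)) :
    eval v ((Dw 𝕜 k n).sliceNumerator s F (X u) u.2) =
      eval v F ^ (u.2 : ℕ) * orbitPoint (pointForm v) (-eval v s / eval v F) u := by
  have hdeg : (orbitMap n (pointForm v) (X u)).natDegree < u.2 + 1 := by
    rw [orbitMap, aeval_X]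
    have h1 := Polynomial.natDegree_iterate_derivative (pointForm v u.1) (n u.1 - u.2)
    have h2 := natDegree_pointForm_le v u.1
    have h3 := u.2.2
    omega
  have hcoeff : ∀ r, (orbitMap n (pointForm v) (X u)).coeff r =
      eval v ((Dw 𝕜 k n)^[r] (X u)) / (r.factorial : 𝕜) := by
    intro r
    have h := Polynomial.eval_zero_iterate_derivative (orbitMap n (pointForm v) (X u)) r
    rw [iterate_derivative_orbitMap (natDegree_pointForm_le v), eval_orbitMap,
      orbitPoint_pointForm_zero] at h
    rw [h]
    field_simp [Nat.factorial_ne_zero]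
  rw [← eval_X (f := orbitPoint (pointForm v) (-eval v s / eval v F)) u, ← eval_orbitMap,
    Polynomial.eval_eq_sum_range' hdeg, Derivation.sliceNumerator, map_sum, mul_sum]
  refine sum_congr rfl fun r hr => ?_
  have hr' : r ≤ u.2 := Nat.le_of_lt_succ (mem_range.1 hr)
  rw [hcoeff, smul_eval, map_mul, map_mul, map_pow, map_pow, div_pow,
    ← Nat.sub_add_cancel hr', pow_add, Nat.add_sub_cancel, neg_pow (eval v s)]
  field_simp

end Orbits

section Degeneration

variable {𝕜 : Type} [Field 𝕜] {k : ℕ} {n : Fin k → ℕ}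

theorem Polynomial.eval_eval_zero {R : Type*} [CommRing R] (g : Polynomial (Polynomial R)) (t : R) :
    (g.eval 0).eval t = (g.map (Polynomial.evalRingHom t)).eval 0 := by
  rw [← Polynomial.coeff_zero_eq_eval_zero, ← Polynomial.coeff_zero_eq_eval_zero,
    Polynomial.coeff_map, Polynomial.coe_evalRingHom]

theorem Polynomial.iterate_derivative_comp_X_sub_C {R : Type*} [CommRing R] (p : Polynomial R)
    (c : R) (m : ℕ) : Polynomial.derivative^[m] (p.comp (Polynomial.X - Polynomial.C c)) =
      (Polynomial.derivative^[m] p).comp (Polynomial.X - Polynomial.C c) := by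
  induction m with
  | zero => rfl
  | succ m ih =>
    rw [Function.iterate_succ_apply', ih, Polynomial.derivative_comp, Polynomial.derivative_X_sub_C,
      one_mul, Function.iterate_succ_apply']

theorem orbitPoint_comp_X_sub_C (P : Fin k → Polynomial 𝕜) (c s : 𝕜) :
    orbitPoint (n := n) (fun j => (P j).comp (Polynomial.X - Polynomial.C c)) s =
      orbitPoint P (s - c) := by
  funext v
  simp [orbitPoint, Polynomial.iterate_derivative_comp_X_sub_C]

/-- The transform of `pointForm v` by the lower unitriangular matrix with entry `t`. -/
noncomputable def lowerForm (v : (Σ j : Fin k, Fin (n j + 1)) → 𝕜) (j : Fin k) :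
    Polynomial (Polynomial 𝕜) :=
  ∑ i : Fin (n j + 1), Polynomial.C (Polynomial.C (v ⟨j, i⟩ / ((n j - i).factorial : 𝕜))) *
    Polynomial.X ^ (n j - i) * (1 + Polynomial.C Polynomial.X * Polynomial.X) ^ (i : ℕ)

/-- The translate of `lowerForm v` by `-1/t`, which has a limit at `t = 0` when `v` is supported on
the second half of the coordinates. -/
noncomputable def translatedForm (v : (Σ j : Fin k, Fin (n j + 1)) → 𝕜) (j : Fin k) :
    Polynomial (Polynomial 𝕜) :=
  ∑ i : Fin (n j + 1), Polynomial.C (Polynomial.C (v ⟨j, i⟩ / ((n j - i).factorial : 𝕜)) *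
    Polynomial.X ^ (2 * i - n j)) *
    (Polynomial.C Polynomial.X * Polynomial.X - 1) ^ (n j - i) * Polynomial.X ^ (i : ℕ)

theorem natDegree_lowerForm_map_le (v : (Σ j : Fin k, Fin (n j + 1)) → 𝕜) (t : 𝕜) (j : Fin k) :
    ((lowerForm v j).map (Polynomial.evalRingHom t)).natDegree ≤ n j := by
  refine Polynomial.natDegree_map_le.trans
    (Polynomial.natDegree_sum_le_of_forall_le _ _ fun i _ => ?_)
  have h1 : (1 + Polynomial.C (Polynomial.X : Polynomial 𝕜) * Polynomial.X).natDegree ≤ 1 := by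
    compute_degree
  have h2 := Polynomial.natDegree_pow_le_of_le (i : ℕ) h1
  have h3 := Polynomial.natDegree_C_mul_X_pow_le
    (Polynomial.C (v ⟨j, i⟩ / ((n j - i).factorial : 𝕜))) (n j - i)
  have := i.2
  refine Polynomial.natDegree_mul_le.trans ((add_le_add h3 h2).trans ?_)
  omega

theorem translatedForm_map {v : (Σ j : Fin k, Fin (n j + 1)) → 𝕜}
    (hv : ∀ u, 2 * (u.2 : ℕ) < n u.1 → v u = 0) {t : 𝕜} (ht : t ≠ 0) (j : Fin k) :
    (translatedForm v j).map (Polynomial.evalRingHom t) =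
      ((lowerForm v j).map (Polynomial.evalRingHom t)).comp
        (Polynomial.X - Polynomial.C t⁻¹) := by
  simp only [translatedForm, lowerForm, Polynomial.map_sum, Polynomial.sum_comp]
  refine sum_congr rfl fun i _ => ?_
  by_cases hi : 2 * (i : ℕ) < n j
  · simp [hv ⟨j, i⟩ hi]
  have hC : (Polynomial.C t * Polynomial.C t⁻¹ : Polynomial 𝕜) = 1 := by
    rw [← Polynomial.C_mul, mul_inv_cancel₀ ht, Polynomial.C_1]
  have h1 : (1 + Polynomial.C t * (Polynomial.X - Polynomial.C t⁻¹) : Polynomial 𝕜) =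
      Polynomial.C t * Polynomial.X := by
    linear_combination (-1 : Polynomial 𝕜) * hC
  have h2 : (Polynomial.C t * Polynomial.X - 1 : Polynomial 𝕜) =
      Polynomial.C t * (Polynomial.X - Polynomial.C t⁻¹) := by
    linear_combination (1 : Polynomial 𝕜) * hC
  have h3 : (Polynomial.C t : Polynomial 𝕜) ^ (i : ℕ) =
      Polynomial.C t ^ (2 * (i : ℕ) - n j) * Polynomial.C t ^ (n j - (i : ℕ)) := by
    have := i.2
    rw [← pow_add]
    congr 1
    omega
  simp only [Polynomial.map_mul, Polynomial.map_pow, Polynomial.map_C, Polynomial.map_X,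
    Polynomial.map_add, Polynomial.map_sub, Polynomial.map_one, Polynomial.coe_evalRingHom,
    Polynomial.eval_C, Polynomial.eval_X,
    Polynomial.mul_comp, Polynomial.pow_comp, Polynomial.X_comp, Polynomial.C_comp,
    Polynomial.add_comp, Polynomial.one_comp, Polynomial.C_mul, Polynomial.C_pow]
  rw [h1, h2, mul_pow, mul_pow, h3]
  ring

theorem lowerForm_map_zero (v : (Σ j : Fin k, Fin (n j + 1)) → 𝕜) (j : Fin k) :
    (lowerForm v j).map (Polynomial.evalRingHom 0) = pointForm v j := by
  simp [lowerForm, pointForm, Polynomial.map_sum]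

/-- The middle coordinates of `v`, with the signs given by the action of the Weyl group. -/
def signedMiddle (v : (Σ j : Fin k, Fin (n j + 1)) → 𝕜) : (Σ j : Fin k, Fin (n j + 1)) → 𝕜 :=
  fun u => if 2 * (u.2 : ℕ) = n u.1 then (-1) ^ (u.2 : ℕ) * v u else 0

theorem orbitPoint_translatedForm_zero [CharZero 𝕜] {v : (Σ j : Fin k, Fin (n j + 1)) → 𝕜}
    (hv : ∀ u, 2 * (u.2 : ℕ) < n u.1 → v u = 0) :
    orbitPoint (fun j => (translatedForm v j).map (Polynomial.evalRingHom 0)) 0 =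
      signedMiddle v := by
  funext ⟨j, l, hl⟩
  have hform : (translatedForm v j).map (Polynomial.evalRingHom 0) = ∑ i : Fin (n j + 1),
      Polynomial.C (v ⟨j, i⟩ / ((n j - i).factorial : 𝕜) * 0 ^ (2 * (i : ℕ) - n j) *
        (-1) ^ (n j - i)) * Polynomial.X ^ (i : ℕ) := by
    simp [translatedForm, Polynomial.map_sum]
  rw [orbitPoint, Polynomial.eval_zero_iterate_derivative, hform, Polynomial.finsetSum_coeff,
    Finset.sum_eq_single ⟨n j - l, by omega⟩]
  · simp only [Polynomial.coeff_C_mul_X_pow, if_true, signedMiddle]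
    split_ifs with h
    · have e : (⟨j, ⟨n j - l, by omega⟩⟩ : Σ j : Fin k, Fin (n j + 1)) = ⟨j, ⟨l, hl⟩⟩ := by
        congr 2
        omega
      have e1 : n j - l = l := by omega
      rw [e, e1, e1, show 2 * l - n j = 0 by omega]
      field_simp [Nat.factorial_ne_zero]
    · rcases lt_or_gt_of_ne h with h | h
      · rw [zero_pow (by omega)]
        ring
      · rw [hv ⟨j, ⟨n j - l, by omega⟩⟩ (by simp only; omega)]
        ring
  · intro b _ hb
    rw [Polynomial.coeff_C_mul_X_pow, if_neg]
    intro h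
    exact hb (Fin.ext h.symm)
  · simp

theorem eval_aeval_iterate_derivative (P : Fin k → Polynomial (Polynomial 𝕜)) (t : 𝕜)
    (f : MvPolynomial (Σ j : Fin k, Fin (n j + 1)) 𝕜) :
    (aeval (fun u : Σ j : Fin k, Fin (n j + 1) =>
      (Polynomial.derivative^[n u.1 - u.2] (P u.1)).eval 0) f).eval t =
      eval (orbitPoint (fun j => (P j).map (Polynomial.evalRingHom t)) 0) f := by
  induction f using MvPolynomial.induction_on with
  | C a => simp
  | add p q hp hq => simp [hp, hq]
  | mul_X p v hp =>
    rw [map_mul, Polynomial.eval_mul, hp, map_mul, aeval_X, eval_X, Polynomial.eval_eval_zero,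
      ← Polynomial.iterate_derivative_map]
    rfl

theorem eval_signedMiddle [CharZero 𝕜] {v : (Σ j : Fin k, Fin (n j + 1)) → 𝕜}
    (hv : ∀ u, 2 * (u.2 : ℕ) < n u.1 → v u = 0)
    {f : MvPolynomial (Σ j : Fin k, Fin (n j + 1)) 𝕜} (hf : Dw 𝕜 k n f = 0) :
    eval (signedMiddle v) f = eval v f := by
  have heq : Polynomial.X * (aeval (fun u : Σ j : Fin k, Fin (n j + 1) =>
        (Polynomial.derivative^[n u.1 - u.2] (lowerForm v u.1)).eval 0) f) =
      Polynomial.X * (aeval (fun u : Σ j : Fin k, Fin (n j + 1) =>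
        (Polynomial.derivative^[n u.1 - u.2] (translatedForm v u.1)).eval 0) f) := by
    refine Polynomial.funext fun t => ?_
    rcases eq_or_ne t 0 with rfl | ht
    · simp
    rw [Polynomial.eval_mul, Polynomial.eval_mul, eval_aeval_iterate_derivative,
      eval_aeval_iterate_derivative]
    simp only [translatedForm_map hv ht]
    rw [orbitPoint_comp_X_sub_C, eval_orbitPoint_eq (natDegree_lowerForm_map_le v t) hf]
  have h0 := congrArg (Polynomial.eval 0) (mul_left_cancel₀ Polynomial.X_ne_zero heq)
  rw [eval_aeval_iterate_derivative, eval_aeval_iterate_derivative,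
    orbitPoint_translatedForm_zero hv] at h0
  simp only [lowerForm_map_zero] at h0
  rw [orbitPoint_pointForm_zero] at h0
  exact h0.symm

end Degeneration

theorem Fin.sum_ite_succ_eq_mul {A : Type*} [CommRing A] {m : ℕ} (a : Fin m) (g : ℕ → A) :
    ∑ c : Fin m, (if (c : ℕ) + 1 = a then ((a : ℕ) : A) else 0) * g c =
      ((a : ℕ) : A) * g ((a : ℕ) - 1) := by
  obtain ⟨_ | a, ha⟩ := a
  · simp
  · rw [Finset.sum_eq_single ⟨a, by omega⟩]
    · simp
    · intro c _ hc
      rw [if_neg fun h => hc (Fin.ext (Nat.succ_injective h)), zero_mul]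
    · simp

theorem Derivation.map_det_hankel {R A : Type*} [CommRing R] [CommRing A] [Algebra R A]
    (D : Derivation R A A) {m : ℕ} {x : ℕ → A} (h0 : D (x 0) = 0)
    (hx : ∀ i, i + 1 ≤ 2 * m → D (x (i + 1)) = x i) :
    D (Matrix.of fun a b : Fin (m + 1) =>
      (((a + b : ℕ).factorial : ℕ) : A) * x (a + b)).det = 0 := by
  set y : ℕ → A := fun i => (i.factorial : A) * x i with hy
  have hy0 : D (y 0) = 0 := by simp [hy, h0]
  have hys : ∀ i, i + 1 ≤ 2 * m → D (y (i + 1)) = ((i + 1 : ℕ) : A) * y i := by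
    intro i hi
    simp only [hy]
    rw [← nsmul_eq_mul, map_nsmul, hx i hi, nsmul_eq_mul, Nat.factorial_succ, Nat.cast_mul,
      mul_assoc]
  refine D.map_det_eq_zero _
    (Matrix.of fun a b : Fin (m + 1) => if (b : ℕ) + 1 = a then ((a : ℕ) : A) else 0)
    (fun a b hab => ?_) fun a b => ?_
  · have : (a : ℕ) ≤ b := hab
    exact if_neg (by omega)
  · have h1 := Fin.sum_ite_succ_eq_mul a fun c => y (c + b)
    have h2 := Fin.sum_ite_succ_eq_mul b fun c => y (a + c)
    simp only [Matrix.mul_apply, Matrix.transpose_apply, Matrix.of_apply]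
    rw [h1, Finset.sum_congr rfl fun c _ => mul_comm _ _, h2]
    change D (y (a + b)) = _
    rcases Nat.eq_zero_or_pos ((a : ℕ) + b) with h | h
    · obtain ⟨ha, hb⟩ : (a : ℕ) = 0 ∧ (b : ℕ) = 0 := by omega
      simp [ha, hb, hy0]
    · obtain ⟨l, hl⟩ : ∃ l, (a : ℕ) + b = l + 1 := ⟨a + b - 1, by omega⟩
      have ea : ((a : ℕ) : A) * y ((a : ℕ) - 1 + b) = ((a : ℕ) : A) * y l := by
        rcases Nat.eq_zero_or_pos (a : ℕ) with ha | ha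
        · simp [ha]
        · rw [show (a : ℕ) - 1 + b = l by omega]
      have eb : ((b : ℕ) : A) * y ((a : ℕ) + (b - 1)) = ((b : ℕ) : A) * y l := by
        rcases Nat.eq_zero_or_pos (b : ℕ) with hb | hb
        · simp [hb]
        · rw [show (a : ℕ) + (b - 1) = l by omega]
      rw [ea, eb, hl, hys l (by omega), ← add_mul, ← Nat.cast_add, hl]

section Middle

variable {𝕜 : Type} [Field 𝕜] {k : ℕ} {n : Fin k → ℕ}

/-- The exponents `n j / gcd (n i) (n j)` and `n i / gcd (n i) (n j)` make powers of the `i`-th and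
the `j`-th form have the same degree; this is their full transvectant. -/
noncomputable def mixedInvariant (𝕜 : Type) [Field 𝕜] {k : ℕ} (n : Fin k → ℕ) (i j : Fin k) :
    MvPolynomial (Σ j : Fin k, Fin (n j + 1)) 𝕜 :=
  (Dw 𝕜 k n).transvectant (n j / (n i).gcd (n j) * n i)
    (Xv 𝕜 k n i (n i) ^ (n j / (n i).gcd (n j))) (Xv 𝕜 k n j (n j) ^ (n i / (n i).gcd (n j)))

theorem div_gcd_mul_comm (a b : ℕ) : b / a.gcd b * a = a / a.gcd b * b := by
  rw [Nat.div_mul_right_comm (Nat.gcd_dvd_right a b), Nat.div_mul_right_comm (Nat.gcd_dvd_left a b),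
    mul_comm]

theorem Dw_mixedInvariant (i j : Fin k) : Dw 𝕜 k n (mixedInvariant 𝕜 n i j) = 0 := by
  refine (Dw 𝕜 k n).map_transvectant
    ((Dw 𝕜 k n).iterate_pow_eq_zero (Dw_iterate_Xv_eq_zero le_rfl) _) ?_
  rw [div_gcd_mul_comm]
  exact (Dw 𝕜 k n).iterate_pow_eq_zero (Dw_iterate_Xv_eq_zero le_rfl) _

theorem totalDegree_mixedInvariant_le (i j : Fin k) : (mixedInvariant 𝕜 n i j).totalDegree ≤
    n j / (n i).gcd (n j) + n i / (n i).gcd (n j) := by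
  refine (totalDegree_transvectant_le _ _ _).trans (add_le_add ?_ ?_) <;>
  · refine (totalDegree_pow _ _).trans ?_
    exact (Nat.mul_le_mul_left _ (totalDegree_Xv_le _ _)).trans (mul_one _).le

theorem mixedInvariant_mem_twoSummands (i j : Fin k) :
    mixedInvariant 𝕜 n i j ∈ twoSummands 𝕜 n i j :=
  transvectant_mem_twoSummands _ (pow_mem (Xv_mem_twoSummands (Or.inl rfl) _) _)
    (pow_mem (Xv_mem_twoSummands (Or.inr rfl) _) _)

theorem eval_iterate_Xv_pow [CharZero 𝕜] {v : (Σ j : Fin k, Fin (n j + 1)) → 𝕜}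
    (hv : ∀ u, 2 * (u.2 : ℕ) ≠ n u.1 → v u = 0) {j : Fin k} {p : ℕ} (hp : n j = 2 * p) (e r : ℕ) :
    eval v ((Dw 𝕜 k n)^[r] (Xv 𝕜 k n j (n j) ^ e)) = if r = p * e then
      (p * e).factorial * (v ⟨j, ⟨p, by omega⟩⟩ / (p.factorial : 𝕜)) ^ e else 0 := by
  have hform : pointForm v j =
      Polynomial.C (v ⟨j, ⟨p, by omega⟩⟩ / (p.factorial : 𝕜)) * Polynomial.X ^ p := by
    rw [pointForm, Finset.sum_eq_single ⟨p, by omega⟩]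
    · rw [show n j - p = p by omega]
    · intro b _ hb
      rw [hv ⟨j, b⟩ fun h => hb (Fin.ext (by simp only at h ⊢; omega))]
      simp
    · simp
  have h := Polynomial.eval_zero_iterate_derivative
    (orbitMap n (pointForm v) (Xv 𝕜 k n j (n j) ^ e)) r
  rw [iterate_derivative_orbitMap (natDegree_pointForm_le v), eval_orbitMap,
    orbitPoint_pointForm_zero, map_pow, orbitMap_Xv _ le_rfl, Nat.sub_self, Function.iterate_zero,
    id, hform, mul_pow, ← Polynomial.C_pow, ← pow_mul, Polynomial.coeff_C_mul_X_pow] at h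
  rw [h]
  split_ifs with hr
  · rw [hr]
  · rw [mul_zero]

theorem exists_eval_mixedInvariant [CharZero 𝕜] {i j : Fin k} {p q : ℕ} (hp : n i = 2 * p)
    (hq : n j = 2 * q) : ∃ c : 𝕜, c ≠ 0 ∧ ∀ v : (Σ j : Fin k, Fin (n j + 1)) → 𝕜,
      (∀ u, 2 * (u.2 : ℕ) ≠ n u.1 → v u = 0) →
      eval v (mixedInvariant 𝕜 n i j) =
        c * (v ⟨i, ⟨p, by omega⟩⟩ ^ (n j / (n i).gcd (n j)) *
          v ⟨j, ⟨q, by omega⟩⟩ ^ (n i / (n i).gcd (n j))) := by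
  set a := n j / (n i).gcd (n j) with ha
  set b := n i / (n i).gcd (n j) with hb
  have hab : a * n i = b * n j := div_gcd_mul_comm _ _
  have hpq : p * a = q * b := by
    rw [hp, hq] at hab
    linarith
  refine ⟨(-1) ^ (p * a) * (((p * a).factorial / (p.factorial : 𝕜) ^ a) *
    ((q * b).factorial / (q.factorial : 𝕜) ^ b)), ?_, fun v hv => ?_⟩
  · have := Nat.factorial_ne_zero
    have h1 : ∀ m : ℕ, (m.factorial : 𝕜) ≠ 0 := fun m => Nat.cast_ne_zero.2 (this m)
    exact mul_ne_zero (pow_ne_zero _ (by simp)) (mul_ne_zero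
      (div_ne_zero (h1 _) (pow_ne_zero _ (h1 _))) (div_ne_zero (h1 _) (pow_ne_zero _ (h1 _))))
  · rw [mixedInvariant, Derivation.transvectant, map_sum, Finset.sum_eq_single (p * a)]
    · simp only [map_mul, map_pow, map_neg, map_one]
      rw [eval_iterate_Xv_pow hv hp, eval_iterate_Xv_pow hv hq, if_pos rfl, if_pos]
      · rw [div_pow, div_pow]
        ring
      · rw [← ha, ← hpq, hp, mul_left_comm, mul_comm a p]
        omega
    · intro r _ hr
      rw [map_mul, map_mul, eval_iterate_Xv_pow hv hp, if_neg hr, zero_mul, mul_zero]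
    · intro h
      refine absurd (mem_range.2 ?_) h
      rw [← ha, hp, mul_left_comm, mul_comm a p]
      omega

/-- The catalecticant matrix of the form with index `j`. -/
noncomputable def hankelMatrix (𝕜 : Type) [Field 𝕜] {k : ℕ} (n : Fin k → ℕ) (j : Fin k) :
    Matrix (Fin (n j / 2 + 1)) (Fin (n j / 2 + 1))
      (MvPolynomial (Σ j : Fin k, Fin (n j + 1)) 𝕜) :=
  Matrix.of fun a b => ((a + b : ℕ).factorial : MvPolynomial _ 𝕜) * Xv 𝕜 k n j (a + b)

theorem Dw_det_hankelMatrix (j : Fin k) : Dw 𝕜 k n (hankelMatrix 𝕜 n j).det = 0 :=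
  (Dw 𝕜 k n).map_det_hankel (m := n j / 2) (Dw_Xv_zero j) fun i hi => Dw_Xv_succ (by omega)

theorem totalDegree_det_hankelMatrix_le (j : Fin k) :
    (hankelMatrix 𝕜 n j).det.totalDegree ≤ n j / 2 + 1 := by
  rw [Matrix.det_apply]
  refine totalDegree_finsetSum_le fun σ _ => ?_
  have h : (∏ i, hankelMatrix 𝕜 n j (σ i) i).totalDegree ≤ n j / 2 + 1 := by
    refine (totalDegree_finsetProd _ _).trans ?_
    refine (sum_le_card_nsmul _ _ 1 fun i _ => ?_).trans (by simp)
    rw [hankelMatrix, Matrix.of_apply, ← nsmul_eq_mul]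
    exact (totalDegree_smul_le _ _).trans (totalDegree_Xv_le _ _)
  rcases Int.units_eq_one_or (Equiv.Perm.sign σ) with hσ | hσ <;> simpa [hσ] using h

theorem det_hankelMatrix_mem_twoSummands (j : Fin k) :
    (hankelMatrix 𝕜 n j).det ∈ twoSummands 𝕜 n j j := by
  rw [Matrix.det_apply']
  exact sum_mem fun σ _ => mul_mem (intCast_mem _ _) <| prod_mem fun i _ =>
    mul_mem (natCast_mem _ _) (Xv_mem_twoSummands (Or.inl rfl) _)

theorem exists_eval_det_hankelMatrix [CharZero 𝕜] {j : Fin k} {p : ℕ} (hp : n j = 2 * p) :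
    ∃ c : 𝕜, c ≠ 0 ∧ ∀ v : (Σ j : Fin k, Fin (n j + 1)) → 𝕜,
      (∀ u, 2 * (u.2 : ℕ) ≠ n u.1 → v u = 0) →
      eval v (hankelMatrix 𝕜 n j).det = c * v ⟨j, ⟨p, by omega⟩⟩ ^ (p + 1) := by
  have hfac : (p.factorial : 𝕜) ≠ 0 := Nat.cast_ne_zero.2 p.factorial_ne_zero
  have hp2 : n j / 2 = p := by omega
  set e : 𝕜 := ((Equiv.Perm.sign (Fin.revPerm : Equiv.Perm (Fin (n j / 2 + 1))) : ℤ) : 𝕜) with he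
  have hee : e * e = 1 := by
    rw [he, ← Int.cast_mul, ← Units.val_mul, Int.units_mul_self]
    simp
  refine ⟨e * p.factorial ^ (p + 1),
    mul_ne_zero (left_ne_zero_of_mul_eq_one hee) (pow_ne_zero _ hfac), fun v hv => ?_⟩
  have hsub : ((eval v).mapMatrix (hankelMatrix 𝕜 n j)).submatrix Fin.revPerm id =
      Matrix.diagonal fun _ => (p.factorial : 𝕜) * v ⟨j, ⟨p, by omega⟩⟩ := by
    ext a b
    have ha := a.2
    have hb := b.2
    have hrev : ((Fin.rev a : Fin (n j / 2 + 1)) : ℕ) = p - a := by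
      rw [Fin.val_rev]
      omega
    simp only [Matrix.submatrix_apply, RingHom.mapMatrix_apply, Matrix.map_apply, hankelMatrix,
      Matrix.of_apply, Fin.revPerm_apply, id, map_mul, map_natCast, hrev]
    rw [Xv_of_le (by omega), eval_X]
    by_cases hab : a = b
    · subst hab
      rw [Matrix.diagonal_apply_eq]
      have : p - (a : ℕ) + a = p := by omega
      simp only [this]
    · have : (a : ℕ) ≠ b := fun h => hab (Fin.ext h)
      rw [Matrix.diagonal_apply_ne _ hab, hv _ (by simp only; omega), mul_zero]
  have hdet := congrArg Matrix.det hsub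
  rw [Matrix.det_permute, Matrix.det_diagonal, prod_const, card_univ, Fintype.card_fin,
    ← RingHom.map_det, ← he] at hdet
  calc eval v (hankelMatrix 𝕜 n j).det = e * e * eval v (hankelMatrix 𝕜 n j).det := by
        rw [hee, one_mul]
    _ = _ := by rw [mul_assoc, hdet, mul_pow, mul_assoc, hp2]

end Middle

section Separating

variable {𝕜 : Type} [Field 𝕜] {k : ℕ} {n : Fin k → ℕ}

/-- The quadratic invariant `∑ r, (-1) ^ r * x_{2i - r, j} * x_{r, j}` for `u = ⟨j, i⟩`. -/
noncomputable def quadric (𝕜 : Type) [Field 𝕜] {k : ℕ} (n : Fin k → ℕ)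
    (u : Σ j : Fin k, Fin (n j + 1)) : MvPolynomial (Σ j : Fin k, Fin (n j + 1)) 𝕜 :=
  (Dw 𝕜 k n).transvectant (2 * u.2) (Xv 𝕜 k n u.1 (2 * u.2)) (Xv 𝕜 k n u.1 (2 * u.2))

theorem Dw_quadric (u : Σ j : Fin k, Fin (n j + 1)) : Dw 𝕜 k n (quadric 𝕜 n u) = 0 := by
  rcases le_or_gt (2 * (u.2 : ℕ)) (n u.1) with h | h
  · exact (Dw 𝕜 k n).map_transvectant (Dw_iterate_Xv_eq_zero h) (Dw_iterate_Xv_eq_zero h)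
  · rw [quadric, Xv, dif_neg h.not_ge]
    refine (Dw 𝕜 k n).map_transvectant ?_ ?_ <;> exact iterate_map_zero _ _

theorem totalDegree_quadric_le (u : Σ j : Fin k, Fin (n j + 1)) :
    (quadric 𝕜 n u).totalDegree ≤ 2 :=
  (totalDegree_transvectant_le _ _ _).trans
    (add_le_add (totalDegree_Xv_le _ _) (totalDegree_Xv_le _ _))

theorem quadric_mem_twoSummands (u : Σ j : Fin k, Fin (n j + 1)) (j : Fin k) :
    quadric 𝕜 n u ∈ twoSummands 𝕜 n u.1 j :=
  transvectant_mem_twoSummands _ (Xv_mem_twoSummands (Or.inl rfl) _)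
    (Xv_mem_twoSummands (Or.inl rfl) _)

theorem eval_quadric {v : (Σ j : Fin k, Fin (n j + 1)) → 𝕜} {u : Σ j : Fin k, Fin (n j + 1)}
    (hu : 2 * (u.2 : ℕ) ≤ n u.1) (hv : ∀ i : Fin (n u.1 + 1), i < u.2 → v ⟨u.1, i⟩ = 0) :
    eval v (quadric 𝕜 n u) = (-1) ^ (u.2 : ℕ) * v u ^ 2 := by
  obtain ⟨j, i, hi⟩ := u
  simp only at hu hv ⊢
  rw [quadric, Derivation.transvectant, map_sum, Finset.sum_eq_single i]
  · rw [show 2 * i - i = i by omega, Dw_iterate_Xv hu (by omega), show 2 * i - i = i by omega,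
      Xv_of_le (by omega)]
    simp [sq]
  · intro r hr hri
    have hr' := mem_range.1 hr
    simp only at hr' ⊢
    rw [Dw_iterate_Xv hu (by omega), Dw_iterate_Xv hu (by omega), Xv_of_le (by omega),
      Xv_of_le (by omega), map_mul, map_mul, eval_X, eval_X]
    rcases lt_or_gt_of_ne hri with h | h
    · rw [hv ⟨2 * i - (2 * i - r), by omega⟩ (Fin.lt_def.2 (by simp only; omega))]
      ring
    · rw [hv ⟨2 * i - r, by omega⟩ (Fin.lt_def.2 (by simp only; omega))]
      ring
  · intro h
    exact absurd (mem_range.2 (by simp only; omega)) h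

/-- The polynomial whose derivative is `quadric 𝕜 n u`. -/
noncomputable def quadricSlice (𝕜 : Type) [Field 𝕜] {k : ℕ} (n : Fin k → ℕ)
    (u : Σ j : Fin k, Fin (n j + 1)) : MvPolynomial (Σ j : Fin k, Fin (n j + 1)) 𝕜 :=
  (Dw 𝕜 k n).transvectantSlice (2 * u.2) (Xv 𝕜 k n u.1 (2 * u.2 + 1))

theorem Dw_quadricSlice {u : Σ j : Fin k, Fin (n j + 1)} (hu : 2 * (u.2 : ℕ) < n u.1) :
    Dw 𝕜 k n (quadricSlice 𝕜 n u) = quadric 𝕜 n u := by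
  rw [quadricSlice, Derivation.map_transvectantSlice _ (Dw_iterate_Xv_eq_zero hu),
    Dw_Xv_succ hu, quadric]

/-- The coordinates of the point where the orbit meets the zero set of `quadricSlice 𝕜 n u`,
cleared of denominators. -/
noncomputable def sliceInvariant (𝕜 : Type) [Field 𝕜] {k : ℕ} (n : Fin k → ℕ)
    (u u' : Σ j : Fin k, Fin (n j + 1)) : MvPolynomial (Σ j : Fin k, Fin (n j + 1)) 𝕜 :=
  (Dw 𝕜 k n).sliceNumerator (quadricSlice 𝕜 n u) (quadric 𝕜 n u) (X u') u'.2

theorem Dw_sliceInvariant [CharZero 𝕜] {u : Σ j : Fin k, Fin (n j + 1)}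
    (hu : 2 * (u.2 : ℕ) < n u.1) (u' : Σ j : Fin k, Fin (n j + 1)) :
    Dw 𝕜 k n (sliceInvariant 𝕜 n u u') = 0 := by
  refine (Dw 𝕜 k n).map_sliceNumerator (Dw_quadricSlice hu) (Dw_quadric u) ?_
  rw [X_eq_Xv]
  exact Dw_iterate_Xv_eq_zero (Nat.le_of_lt_succ u'.2.2)

theorem totalDegree_sliceInvariant_le (u u' : Σ j : Fin k, Fin (n j + 1)) :
    (sliceInvariant 𝕜 n u u').totalDegree ≤ 2 * u'.2 + 1 :=
  totalDegree_sliceNumerator_le ((totalDegree_transvectantSlice_le _ _).trans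
    (add_le_add (totalDegree_Xv_le _ _) (totalDegree_Xv_le _ _))) (totalDegree_quadric_le u)
    (totalDegree_X _).le _

theorem sliceInvariant_mem_twoSummands (u u' : Σ j : Fin k, Fin (n j + 1)) :
    sliceInvariant 𝕜 n u u' ∈ twoSummands 𝕜 n u.1 u'.1 :=
  sliceNumerator_mem_twoSummands
    (transvectantSlice_mem_twoSummands _ (Xv_mem_twoSummands (Or.inl rfl) _))
    (quadric_mem_twoSummands u _) (Algebra.subset_adjoin ⟨_, Or.inr rfl, rfl⟩) _

theorem eval_eq_of_eval_sliceInvariant_eq [CharZero 𝕜] {v w : (Σ j : Fin k, Fin (n j + 1)) → 𝕜}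
    {u : Σ j : Fin k, Fin (n j + 1)} (hF : eval v (quadric 𝕜 n u) = eval w (quadric 𝕜 n u))
    (hF0 : eval v (quadric 𝕜 n u) ≠ 0)
    (hE : ∀ u', eval v (sliceInvariant 𝕜 n u u') = eval w (sliceInvariant 𝕜 n u u'))
    {f : MvPolynomial (Σ j : Fin k, Fin (n j + 1)) 𝕜} (hf : Dw 𝕜 k n f = 0) :
    eval v f = eval w f := by
  have h : orbitPoint (n := n) (pointForm v) (-eval v (quadricSlice 𝕜 n u) /
        eval v (quadric 𝕜 n u)) =
      orbitPoint (pointForm w) (-eval w (quadricSlice 𝕜 n u) /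
        eval w (quadric 𝕜 n u)) := by
    funext u'
    have h := hE u'
    rw [sliceInvariant, eval_sliceNumerator v hF0, eval_sliceNumerator w (hF ▸ hF0), ← hF] at h
    rw [mul_left_cancel₀ (pow_ne_zero _ hF0) h, ← hF]
  rw [← orbitPoint_pointForm_zero v, ← orbitPoint_pointForm_zero w,
    eval_orbitPoint_eq (natDegree_pointForm_le v) hf 0, h,
    eval_orbitPoint_eq (natDegree_pointForm_le w) hf _ 0]

theorem eq_zero_of_eval_quadric_eq_zero {v : (Σ j : Fin k, Fin (n j + 1)) → 𝕜}
    (hv : ∀ u, 2 * (u.2 : ℕ) < n u.1 → eval v (quadric 𝕜 n u) = 0)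
    (u : Σ j : Fin k, Fin (n j + 1)) (hu : 2 * (u.2 : ℕ) < n u.1) : v u = 0 := by
  obtain ⟨j, i, hi⟩ := u
  induction i using Nat.strong_induction_on with
  | _ i ih =>
    have h := hv _ hu
    rw [eval_quadric hu.le fun i' hi' => ih i' hi' i'.2
      (by have := Fin.lt_def.1 hi'; simp only at this hu ⊢; omega)] at h
    simpa using h

/-- The part of a point in the middle coordinates. -/
def middlePart (v : (Σ j : Fin k, Fin (n j + 1)) → 𝕜) : (Σ j : Fin k, Fin (n j + 1)) → 𝕜 :=
  fun u => if 2 * (u.2 : ℕ) = n u.1 then v u else 0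

theorem middlePart_of_ne (v : (Σ j : Fin k, Fin (n j + 1)) → 𝕜) (u : Σ j : Fin k, Fin (n j + 1))
    (hu : 2 * (u.2 : ℕ) ≠ n u.1) : middlePart v u = 0 := if_neg hu

theorem eval_middlePart [CharZero 𝕜] {v : (Σ j : Fin k, Fin (n j + 1)) → 𝕜}
    (hv : ∀ u, 2 * (u.2 : ℕ) < n u.1 → v u = 0)
    {f : MvPolynomial (Σ j : Fin k, Fin (n j + 1)) 𝕜} (hf : Dw 𝕜 k n f = 0) :
    eval (middlePart v) f = eval v f := by
  rw [← eval_signedMiddle hv hf,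
    ← eval_signedMiddle (fun u hu => middlePart_of_ne v u hu.ne) hf]
  congr 2
  funext u
  unfold signedMiddle middlePart
  split_ifs <;> rfl

theorem eq_of_pow_odd_eq_of_sq_eq {x y : 𝕜} {r : ℕ} (h : x ^ (2 * r + 1) = y ^ (2 * r + 1))
    (hs : r ≠ 0 → x ^ 2 = y ^ 2) : x = y := by
  rcases eq_or_ne r 0 with rfl | hr
  · simpa using h
  rcases eq_or_ne y 0 with rfl | hy
  · simpa using hs hr
  rw [pow_succ, pow_succ, pow_mul, pow_mul, hs hr] at h
  exact mul_left_cancel₀ (pow_ne_zero _ (pow_ne_zero _ hy)) h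

theorem mul_eq_mul_of_pow_odd_of_sq_eq {x y x' y' : 𝕜} {r s : ℕ}
    (h : x ^ (2 * r + 1) * y ^ (2 * s + 1) = x' ^ (2 * r + 1) * y' ^ (2 * s + 1))
    (hx : x ^ 2 = x' ^ 2) (hy : y ^ 2 = y' ^ 2) : x * y = x' * y' := by
  rcases eq_or_ne x' 0 with rfl | hx'
  · simp_all
  rcases eq_or_ne y' 0 with rfl | hy'
  · simp_all
  rw [pow_succ, pow_succ, pow_succ, pow_succ, pow_mul, pow_mul, pow_mul, pow_mul, hx, hy] at h
  refine mul_left_cancel₀ (mul_ne_zero (pow_ne_zero r (pow_ne_zero 2 hx'))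
    (pow_ne_zero s (pow_ne_zero 2 hy'))) ?_
  linear_combination h

theorem eq_or_eq_signedMiddle {c d : (Σ j : Fin k, Fin (n j + 1)) → 𝕜}
    (hc : ∀ u, 2 * (u.2 : ℕ) ≠ n u.1 → c u = 0) (hd : ∀ u, 2 * (u.2 : ℕ) ≠ n u.1 → d u = 0)
    (hsq : ∀ u, 2 * (u.2 : ℕ) = n u.1 → n u.1 ≠ 0 → c u ^ 2 = d u ^ 2)
    (heven : ∀ u, 2 * (u.2 : ℕ) = n u.1 → n u.1 % 4 = 0 → c u = d u)
    (hodd : ∀ u u', 2 * (u.2 : ℕ) = n u.1 → 2 * (u'.2 : ℕ) = n u'.1 → n u.1 % 4 = 2 →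
      n u'.1 % 4 = 2 → c u * c u' = d u * d u') : c = d ∨ c = signedMiddle d := by
  by_cases h : ∀ u, 2 * (u.2 : ℕ) = n u.1 → n u.1 % 4 = 2 → c u = d u
  · left
    funext u
    by_cases hu : 2 * (u.2 : ℕ) = n u.1
    · by_cases h4 : n u.1 % 4 = 0
      · exact heven u hu h4
      · exact h u hu (by omega)
    · rw [hc u hu, hd u hu]
  · push Not at h
    obtain ⟨u, hu, hu4, hne⟩ := h
    have hneg : c u = -d u := (sq_eq_sq_iff_eq_or_eq_neg.1 (hsq u hu (by omega))).resolve_left hne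
    have hd0 : d u ≠ 0 := fun h0 => hne (by rw [hneg, h0, neg_zero])
    right
    funext u'
    unfold signedMiddle
    split_ifs with hu'
    · by_cases h4 : n u'.1 % 4 = 0
      · rw [heven u' hu' h4, Even.neg_one_pow (by rw [Nat.even_iff]; omega), one_mul]
      · have h := hodd u u' hu hu' hu4 (by omega)
        rw [Odd.neg_one_pow (by rw [Nat.odd_iff]; omega)]
        refine mul_left_cancel₀ hd0 ?_
        rw [hneg] at h
        linear_combination -h
    · exact hc u' hu'

theorem div_gcd_odd {a b : ℕ} (ha : a % 4 = 2) (hb : b % 4 = 2) : Odd (b / a.gcd b) := by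
  rw [← Nat.not_even_iff_odd]
  rintro ⟨q, hq⟩
  obtain ⟨g, hg⟩ : 2 ∣ a.gcd b := Nat.dvd_gcd (by omega) (by omega)
  have h := Nat.div_mul_cancel (Nat.gcd_dvd_right a b)
  rw [hq, hg] at h
  have : b = 4 * (q * g) := by rw [← h]; ring
  omega

/-- Invariants separating the points supported in the middle coordinates. -/
noncomputable def middleInvariant (𝕜 : Type) [Field 𝕜] {k : ℕ} (n : Fin k → ℕ) (i j : Fin k) :
    MvPolynomial (Σ j : Fin k, Fin (n j + 1)) 𝕜 :=
  if n i % 4 = 2 ∧ n j % 4 = 2 then mixedInvariant 𝕜 n i j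
  else if n i % 4 = 0 then (hankelMatrix 𝕜 n i).det else 0

theorem Dw_middleInvariant (i j : Fin k) : Dw 𝕜 k n (middleInvariant 𝕜 n i j) = 0 := by
  unfold middleInvariant
  split_ifs
  · exact Dw_mixedInvariant i j
  · exact Dw_det_hankelMatrix i
  · exact map_zero _

theorem succ_le_sum (n : Fin k → ℕ) (j : Fin k) : n j + 1 ≤ ∑ j, (n j + 1) :=
  single_le_sum (f := fun j => n j + 1) (fun _ _ => Nat.zero_le _) (mem_univ j)

theorem totalDegree_middleInvariant_le (i j : Fin k) :
    (middleInvariant 𝕜 n i j).totalDegree ≤ 2 * (∑ j, (n j + 1)) - 1 := by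
  have hi := succ_le_sum n i
  have hj := succ_le_sum n j
  unfold middleInvariant
  split_ifs with h
  · refine (totalDegree_mixedInvariant_le i j).trans ?_
    have hi' := Nat.div_le_self (n i) ((n i).gcd (n j))
    have hj' := Nat.div_le_self (n j) ((n i).gcd (n j))
    omega
  · refine (totalDegree_det_hankelMatrix_le i).trans ?_
    omega
  · simp

theorem middleInvariant_mem_twoSummands (i j : Fin k) :
    ∃ j1 j2, middleInvariant 𝕜 n i j ∈ twoSummands 𝕜 n j1 j2 := by
  unfold middleInvariant
  split_ifs
  · exact ⟨i, j, mixedInvariant_mem_twoSummands i j⟩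
  · exact ⟨i, i, det_hankelMatrix_mem_twoSummands i⟩
  · exact ⟨i, j, zero_mem _⟩

theorem eval_eq_of_eval_middleInvariant_eq [CharZero 𝕜]
    {c d : (Σ j : Fin k, Fin (n j + 1)) → 𝕜}
    (hc : ∀ u, 2 * (u.2 : ℕ) ≠ n u.1 → c u = 0) (hd : ∀ u, 2 * (u.2 : ℕ) ≠ n u.1 → d u = 0)
    (hq : ∀ u, n u.1 ≠ 0 → eval c (quadric 𝕜 n u) = eval d (quadric 𝕜 n u))
    (hm : ∀ i j, eval c (middleInvariant 𝕜 n i j) = eval d (middleInvariant 𝕜 n i j))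
    {f : MvPolynomial (Σ j : Fin k, Fin (n j + 1)) 𝕜} (hf : Dw 𝕜 k n f = 0) :
    eval c f = eval d f := by
  have hsq : ∀ u, 2 * (u.2 : ℕ) = n u.1 → n u.1 ≠ 0 → c u ^ 2 = d u ^ 2 := by
    intro u hu h0
    have h := hq u h0
    have hlt : ∀ i : Fin (n u.1 + 1), i < u.2 → 2 * (i : ℕ) ≠ n u.1 := by
      intro i hi
      have := Fin.lt_def.1 hi
      omega
    rw [eval_quadric hu.le fun i hi => hc _ (hlt i hi),
      eval_quadric hu.le fun i hi => hd _ (hlt i hi)] at h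
    exact mul_left_cancel₀ (pow_ne_zero _ (by simp)) h
  have heven : ∀ u, 2 * (u.2 : ℕ) = n u.1 → n u.1 % 4 = 0 → c u = d u := by
    intro u hu h4
    obtain ⟨a, ha, hev⟩ := exists_eval_det_hankelMatrix (𝕜 := 𝕜) hu.symm
    have h := hm u.1 u.1
    rw [middleInvariant, if_neg (by omega), if_pos h4, hev c hc, hev d hd] at h
    obtain ⟨r, hr⟩ : ∃ r, (u.2 : ℕ) = 2 * r := ⟨u.2 / 2, by omega⟩
    refine eq_of_pow_odd_eq_of_sq_eq (r := r) ?_ fun hr0 => hsq u hu (by omega)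
    rw [← hr]
    exact mul_left_cancel₀ ha h
  have hodd : ∀ u u', 2 * (u.2 : ℕ) = n u.1 → 2 * (u'.2 : ℕ) = n u'.1 → n u.1 % 4 = 2 →
      n u'.1 % 4 = 2 → c u * c u' = d u * d u' := by
    intro u u' hu hu' h4 h4'
    obtain ⟨a, ha, hev⟩ := exists_eval_mixedInvariant (𝕜 := 𝕜) hu.symm hu'.symm
    have h := hm u.1 u'.1
    rw [middleInvariant, if_pos ⟨h4, h4'⟩, hev c hc, hev d hd] at h
    obtain ⟨r, hr⟩ := div_gcd_odd h4 h4'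
    obtain ⟨s, hs⟩ := div_gcd_odd h4' h4
    rw [Nat.gcd_comm] at hs
    rw [hr, hs] at h
    exact mul_eq_mul_of_pow_odd_of_sq_eq (mul_left_cancel₀ ha h) (hsq u hu (by omega))
      (hsq u' hu' (by omega))
  rcases eq_or_eq_signedMiddle hc hd hsq heven hodd with h | h
  · rw [h]
  · rw [h, eval_signedMiddle (fun u hu => hd u hu.ne) hf]

/-- The finite separating set. -/
def separatingSet (𝕜 : Type) [Field 𝕜] {k : ℕ} (n : Fin k → ℕ) :
    Set (MvPolynomial (Σ j : Fin k, Fin (n j + 1)) 𝕜) :=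
  quadric 𝕜 n '' {u | n u.1 ≠ 0} ∪
    Function.uncurry (sliceInvariant 𝕜 n) '' {p | 2 * (p.1.2 : ℕ) < n p.1.1} ∪
    Set.range (Function.uncurry (middleInvariant 𝕜 n))

theorem finite_separatingSet : (separatingSet 𝕜 n).Finite :=
  ((Set.toFinite _).union (Set.toFinite _)).union (Set.toFinite _)

theorem ncard_image_le_card {α β : Type*} [Fintype α] (f : α → β) (s : Set α) :
    (f '' s).ncard ≤ Fintype.card α :=
  (Set.ncard_image_le (Set.toFinite s)).trans <|
    (Set.ncard_le_card s).trans_eq Nat.card_eq_fintype_card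

theorem ncard_separatingSet_le : (separatingSet 𝕜 n).ncard ≤ 3 * (∑ j, (n j + 1)) ^ 2 := by
  have hcard : Fintype.card (Σ j : Fin k, Fin (n j + 1)) = ∑ j, (n j + 1) := by simp
  have hk : k ≤ ∑ j, (n j + 1) := by
    rw [sum_add_distrib]
    simp
  have h := Set.ncard_union_le (quadric 𝕜 n '' {u | n u.1 ≠ 0} ∪
    Function.uncurry (sliceInvariant 𝕜 n) '' {p | 2 * (p.1.2 : ℕ) < n p.1.1})
    (Set.range (Function.uncurry (middleInvariant 𝕜 n)))
  have h' := Set.ncard_union_le (quadric 𝕜 n '' {u | n u.1 ≠ 0})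
    (Function.uncurry (sliceInvariant 𝕜 n) '' {p | 2 * (p.1.2 : ℕ) < n p.1.1})
  have h1 := ncard_image_le_card (quadric 𝕜 n) {u | n u.1 ≠ 0}
  have h2 := ncard_image_le_card
    (Function.uncurry (sliceInvariant 𝕜 n)) {p | 2 * (p.1.2 : ℕ) < n p.1.1}
  have h3 := ncard_image_le_card
    (Function.uncurry (middleInvariant 𝕜 n)) Set.univ
  rw [Set.image_univ, Fintype.card_prod, Fintype.card_fin] at h3
  rw [Fintype.card_prod, hcard] at h2
  rw [hcard] at h1
  have hkk := Nat.mul_le_mul hk hk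
  have hN := Nat.le_self_pow two_ne_zero (∑ j, (n j + 1))
  rw [sq] at hN ⊢
  unfold separatingSet
  omega

theorem Dw_eq_zero_of_mem_separatingSet [CharZero 𝕜]
    {f : MvPolynomial (Σ j : Fin k, Fin (n j + 1)) 𝕜} (hf : f ∈ separatingSet 𝕜 n) :
    Dw 𝕜 k n f = 0 := by
  rcases hf with (⟨u, -, rfl⟩ | ⟨p, hp, rfl⟩) | ⟨p, rfl⟩
  · exact Dw_quadric u
  · exact Dw_sliceInvariant hp p.2
  · exact Dw_middleInvariant p.1 p.2

theorem totalDegree_le_of_mem_separatingSet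
    {f : MvPolynomial (Σ j : Fin k, Fin (n j + 1)) 𝕜} (hf : f ∈ separatingSet 𝕜 n) :
    f.totalDegree ≤ 2 * (∑ j, (n j + 1)) - 1 := by
  rcases hf with (⟨u, hu, rfl⟩ | ⟨p, -, rfl⟩) | ⟨p, rfl⟩
  · have h := succ_le_sum n u.1
    have hu' : n u.1 ≠ 0 := hu
    exact (totalDegree_quadric_le u).trans (by omega)
  · have h := succ_le_sum n p.2.1
    have hp := p.2.2.2
    exact (totalDegree_sliceInvariant_le p.1 p.2).trans (by omega)
  · exact totalDegree_middleInvariant_le p.1 p.2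

theorem mem_twoSummands_of_mem_separatingSet
    {f : MvPolynomial (Σ j : Fin k, Fin (n j + 1)) 𝕜} (hf : f ∈ separatingSet 𝕜 n) :
    ∃ j1 j2, f ∈ twoSummands 𝕜 n j1 j2 := by
  rcases hf with (⟨u, -, rfl⟩ | ⟨p, -, rfl⟩) | ⟨p, rfl⟩
  · exact ⟨u.1, u.1, quadric_mem_twoSummands u u.1⟩
  · exact ⟨_, _, sliceInvariant_mem_twoSummands p.1 p.2⟩
  · exact middleInvariant_mem_twoSummands p.1 p.2

theorem eval_eq_of_eval_separatingSet_eq [CharZero 𝕜] {v w : (Σ j : Fin k, Fin (n j + 1)) → 𝕜}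
    (h : ∀ s ∈ separatingSet 𝕜 n, eval v s = eval w s)
    {f : MvPolynomial (Σ j : Fin k, Fin (n j + 1)) 𝕜} (hf : Dw 𝕜 k n f = 0) :
    eval v f = eval w f := by
  have hq : ∀ u, n u.1 ≠ 0 → eval v (quadric 𝕜 n u) = eval w (quadric 𝕜 n u) :=
    fun u hu => h _ (Or.inl (Or.inl ⟨u, hu, rfl⟩))
  by_cases hF : ∃ u : Σ j : Fin k, Fin (n j + 1), 2 * (u.2 : ℕ) < n u.1 ∧
    eval v (quadric 𝕜 n u) ≠ 0
  · obtain ⟨u, hu, hF0⟩ := hF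
    exact eval_eq_of_eval_sliceInvariant_eq (hq u (Nat.ne_zero_of_lt hu)) hF0
      (fun u' => h _ (Or.inl (Or.inr ⟨(u, u'), hu, rfl⟩))) hf
  · push Not at hF
    have hv := eq_zero_of_eval_quadric_eq_zero hF
    have hw := eq_zero_of_eval_quadric_eq_zero fun u hu =>
      (hq u (Nat.ne_zero_of_lt hu)).symm.trans (hF u hu)
    rw [← eval_middlePart hv hf, ← eval_middlePart hw hf]
    refine eval_eq_of_eval_middleInvariant_eq (middlePart_of_ne v) (middlePart_of_ne w)
      (fun u hu => ?_) (fun i j => ?_) hf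
    · rw [eval_middlePart hv (Dw_quadric u), eval_middlePart hw (Dw_quadric u), hq u hu]
    · rw [eval_middlePart hv (Dw_middleInvariant i j), eval_middlePart hw (Dw_middleInvariant i j)]
      exact h _ (Or.inr ⟨(i, j), rfl⟩)

end Separating

theorem mainTheoremIntro (𝕜 : Type) [Field 𝕜] [CharZero 𝕜] (k : ℕ) (hk : 1 ≤ k)
    (n : Fin k → ℕ) :
    ∃ S : Set (MvPolynomial (Σ j : Fin k, Fin (n j + 1)) 𝕜),
      -- `S` is a finite set of invariants
      S.Finite ∧ (∀ f ∈ S, Dw 𝕜 k n f = 0) ∧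
      -- (1) invariants of degree at most `2n - 1`, where `n = ∑ (n_j + 1) = dim V`
      (∀ f ∈ S, f.totalDegree ≤ 2 * (∑ j, (n j + 1)) - 1) ∧
      -- (2) the size of `S` is quadratic in `n`
      S.ncard ≤ 3 * (∑ j, (n j + 1)) ^ 2 ∧
      -- (3) each invariant involves variables coming from at most 2 summands
      (∀ f ∈ S, ∃ j1 j2 : Fin k,
        f ∈ Algebra.adjoin 𝕜
          {p : MvPolynomial (Σ j : Fin k, Fin (n j + 1)) 𝕜 |
            ∃ v : Σ j : Fin k, Fin (n j + 1), (v.1 = j1 ∨ v.1 = j2) ∧ p = MvPolynomial.X v}) ∧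
      -- `S` is a separating set for `ker D = 𝕜[V]^{𝔾ₐ}`
      (∀ v w : (Σ j : Fin k, Fin (n j + 1)) → 𝕜,
        (∃ f, Dw 𝕜 k n f = 0 ∧ eval v f ≠ eval w f) →
        ∃ s ∈ S, eval v s ≠ eval w s) := by
  refine ⟨separatingSet 𝕜 n, finite_separatingSet, fun f => Dw_eq_zero_of_mem_separatingSet,
    fun f => totalDegree_le_of_mem_separatingSet, ncard_separatingSet_le,
    fun f => mem_twoSummands_of_mem_separatingSet, fun v w ⟨f, hf, hne⟩ => ?_⟩
  by_contra! h
  exact hne (eval_eq_of_eval_separatingSet_eq h hf)
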